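/- There is an absolute constant C such that for all real P ≥ 2, all R with 2 ≤ R ≤ P, and all nonzero integers a, b, c, d, one has I(a,b,c,d) ≤ C·( P⁹ + Σ_{n∈ℤ, |n|≤P⁹, |ψ(n)|>1} |ψ(n)|³ ). -/

import Mathlib

open scoped Real
open Filter MeasureTheory

noncomputable section

/-- `e(z) = exp(2πiz)`. -/
def e (z : ℝ) : ℂ := Complex.exp (2 * Real.pi * Complex.I * z)

/-- The set `𝒜(P,R)` of `R`-smooth positive integers not exceeding `P`. -/
def smoothA (P R : ℝ) : Finset ℕ :=
  (Finset.Icc 1 ⌊P⌋₊).filter (fun n => ∀ p ∈ n.primeFactors, (p : ℝ) ≤ R)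

/-- The smooth Weyl sum `h(α; P, R)`. -/
def h (P R α : ℝ) : ℂ := ∑ x ∈ smoothA P R, e (α * (x : ℝ) ^ 4)

/-- `Δ₇ = 0.849408`. -/
def Δ₇ : ℝ := 0.849408

/-- `Δ₁₀ = 0.213431`. -/
def Δ₁₀ : ℝ := 0.213431

/-- The Fourier coefficient `ψ(n) = ∫₀¹ |h(α)|⁷ e(-nα) dα`. -/
def ψ (P R : ℝ) (n : ℤ) : ℂ :=
  ∫ α in (0:ℝ)..1, (‖h P R α‖ : ℂ) ^ 7 * e (-(n : ℝ) * α)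

/-- The correlation integral `I(a,b,c,d) = ∫₀¹∫₀¹ |h(aα)h(bβ)h(cα+dβ)|⁷ dα dβ`. -/
def Icorr (P R : ℝ) (a b c d : ℤ) : ℝ :=
  ∫ α in (0:ℝ)..1, ∫ β in (0:ℝ)..1,
    ‖h P R ((a : ℝ) * α) * h P R ((b : ℝ) * β) * h P R ((c : ℝ) * α + (d : ℝ) * β)‖ ^ 7

lemma e_zero : e 0 = 1 := by simp [e]

lemma norm_e (x : ℝ) : ‖e x‖ = 1 := by
  have : 2 * (π : ℂ) * Complex.I * x = ((2 * π * x : ℝ) : ℂ) * Complex.I := by push_cast; ring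
  rw [e, this, Complex.norm_exp_ofReal_mul_I]

lemma e_add (x y : ℝ) : e (x + y) = e x * e y := by
  rw [e, e, e, ← Complex.exp_add]
  push_cast
  ring_nf

lemma e_int (n : ℤ) : e n = 1 := by
  rw [e, Complex.exp_eq_one_iff]
  exact ⟨n, by push_cast; ring⟩

@[fun_prop]
lemma continuous_e : Continuous e := by
  unfold e
  fun_prop

lemma hasDerivAt_e_mul (k x : ℝ) :
    HasDerivAt (fun y : ℝ => e (k * y)) (2 * π * Complex.I * k * e (k * x)) x := by
  have h1 : HasDerivAt (fun y : ℝ => 2 * (π : ℂ) * Complex.I * ((k * y : ℝ) : ℂ))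
      (2 * π * Complex.I * ((k * 1 : ℝ) : ℂ)) x :=
    (((hasDerivAt_id x).const_mul k).ofReal_comp).const_mul _
  have h2 := h1.cexp
  unfold e
  convert h2 using 1
  push_cast
  ring

/-- The Fourier coefficients of a `1`-periodic function. -/
def coeff (f : ℝ → ℂ) (n : ℤ) : ℂ := ∫ x in (0:ℝ)..1, f x * e (-(n : ℝ) * x)

lemma coeff_deriv {f f' : ℝ → ℂ} (hf : ∀ x, HasDerivAt f (f' x) x) (hf' : Continuous f')
    (hper : f 1 = f 0) (n : ℤ) : coeff f' n = 2 * π * Complex.I * n * coeff f n := by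
  have hc : Continuous f := continuous_iff_continuousAt.2 fun x => (hf x).continuousAt
  have key := intervalIntegral.integral_mul_deriv_eq_deriv_mul (a := 0) (b := 1)
    (fun x _ => hf x) (fun x _ => hasDerivAt_e_mul (-(n : ℝ)) x)
    (hf'.intervalIntegrable _ _)
    ((by fun_prop : Continuous fun x : ℝ =>
      2 * (π : ℂ) * Complex.I * ((-(n : ℝ) : ℝ) : ℂ) * e (-(n : ℝ) * x)).intervalIntegrable _ _)
  have h1 : e (-(n : ℝ) * 1) = 1 := by
    have := e_int (-n)
    push_cast at this
    simpa using this
  rw [h1, mul_zero, e_zero, hper, sub_self, zero_sub] at key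
  have h2 : ∀ x : ℝ, f x * (2 * (π : ℂ) * Complex.I * ((-(n : ℝ) : ℝ) : ℂ) * e (-(n : ℝ) * x))
      = (-(2 * π * Complex.I * n)) * (f x * e (-(n : ℝ) * x)) := by
    intro x
    push_cast
    ring
  simp only [h2] at key
  rw [intervalIntegral.integral_const_mul] at key
  unfold coeff
  linear_combination key

lemma norm_coeff_le {f : ℝ → ℂ} {B : ℝ} (hB : ∀ x, ‖f x‖ ≤ B) (n : ℤ) : ‖coeff f n‖ ≤ B := by
  have := intervalIntegral.norm_integral_le_of_norm_le_const (a := 0) (b := 1) (C := B)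
    (f := fun x => f x * e (-(n : ℝ) * x)) (fun x _ => by rw [norm_mul, norm_e, mul_one]; exact hB x)
  simpa [coeff] using this

lemma norm_coeff_le_of_deriv_two {f f' f'' : ℝ → ℂ} (hf : ∀ x, HasDerivAt f (f' x) x)
    (hf' : ∀ x, HasDerivAt f' (f'' x) x) (hf'' : Continuous f'') (hper : f 1 = f 0)
    (hper' : f' 1 = f' 0) {B : ℝ} (hB : ∀ x, ‖f'' x‖ ≤ B) {n : ℤ} :
    4 * π ^ 2 * (n : ℝ) ^ 2 * ‖coeff f n‖ ≤ B := by
  have hc : Continuous f' := continuous_iff_continuousAt.2 fun x => (hf' x).continuousAt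
  have h1 := coeff_deriv hf hc hper n
  have h2 := coeff_deriv hf' hf'' hper' n
  have h3 := norm_coeff_le hB n
  rw [h2, h1] at h3
  simp only [norm_mul, Complex.norm_I, Complex.norm_ofNat, Complex.norm_real, Complex.norm_intCast,
    Real.norm_eq_abs, abs_of_pos Real.pi_pos] at h3
  rw [← sq_abs (n : ℝ)]
  linarith

lemma hasSum_coeff {f : ℝ → ℂ} (hf : Continuous f) (hper : Function.Periodic f 1)
    (hs : Summable (coeff f)) (x : ℝ) : HasSum (fun n : ℤ => coeff f n * e (n * x)) (f x) := by
  have : Fact ((0 : ℝ) < 1) := ⟨one_pos⟩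
  let F : C(AddCircle (1 : ℝ), ℂ) := ⟨hper.lift, continuous_quot_lift _ hf⟩
  have hF : ∀ y : ℝ, F (y : AddCircle (1 : ℝ)) = f y := fun y => hper.lift_coe y
  have hco : fourierCoeff F = coeff f := by
    funext n
    rw [fourierCoeff_eq_intervalIntegral _ n 0, coeff]
    simp only [zero_add, div_one, one_smul, smul_eq_mul]
    refine intervalIntegral.integral_congr fun y _ => ?_
    simp only [hF, fourier_coe_apply, e]
    rw [mul_comm]
    congr 2
    push_cast
    ring
  have := has_pointwise_sum_fourier_series_of_summable (f := F) (by rw [hco]; exact hs)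
    (x : AddCircle (1 : ℝ))
  rw [hF, hco] at this
  convert this using 2 with n
  rw [smul_eq_mul, fourier_coe_apply, e]
  congr 2
  push_cast
  ring

lemma hasSum_of_eq {u v : ℤ → ℂ} {z : ℂ} (huv : ∀ n, u n = v n) (hv : HasSum v z) :
    HasSum u z := by
  rwa [funext huv]

lemma hasSum_integral_of_norm_le {u : ℤ → ℝ → ℂ} {s : ℝ → ℂ} {b : ℤ → ℝ}
    (hu : ∀ n, Continuous (u n)) (hb : ∀ n x, ‖u n x‖ ≤ b n) (hsb : Summable b)
    (hs : ∀ x, HasSum (fun n => u n x) (s x)) :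
    HasSum (fun n => ∫ x in (0:ℝ)..1, u n x) (∫ x in (0:ℝ)..1, s x) :=
  intervalIntegral.hasSum_integral_of_dominated_convergence (fun n _ => b n)
    (fun n => (hu n).aestronglyMeasurable) (fun n => .of_forall fun x _ => hb n x)
    (.of_forall fun _ _ => hsb) intervalIntegrable_const (.of_forall fun x _ => hs x)

lemma integral_e_int (k : ℤ) : ∫ x in (0:ℝ)..1, e (k * x) = if k = 0 then 1 else 0 := by
  split_ifs with hk
  · simp [hk, e_zero]
  · have hk' : (2 * π * Complex.I * k : ℂ) ≠ 0 := by
      simp [Complex.I_ne_zero, Real.pi_ne_zero, hk]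
    have h1 : ∫ x in (0:ℝ)..1, 2 * π * Complex.I * ((k : ℝ) : ℂ) * e (k * x) = 0 := by
      rw [intervalIntegral.integral_eq_sub_of_hasDerivAt
        (fun x _ => hasDerivAt_e_mul (k : ℝ) x)
        ((by fun_prop : Continuous _).intervalIntegrable _ _)]
      simp [e_zero, e_int]
    rw [intervalIntegral.integral_const_mul] at h1
    push_cast at h1
    exact (mul_eq_zero.1 h1).resolve_left hk'

/-- The integral `∫₀¹ f(ax) e(kx) dx`. -/
def dilatedCoeff (f : ℝ → ℂ) (a k : ℤ) : ℂ := ∫ x in (0:ℝ)..1, f (a * x) * e (k * x)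

lemma norm_dilatedCoeff_le {f : ℝ → ℂ} {B : ℝ} (hB : ∀ x, ‖f x‖ ≤ B) (a k : ℤ) :
    ‖dilatedCoeff f a k‖ ≤ B := by
  have := intervalIntegral.norm_integral_le_of_norm_le_const (a := 0) (b := 1) (C := B)
    (f := fun x => f (a * x) * e (k * x)) (fun x _ => by rw [norm_mul, norm_e, mul_one]; exact hB _)
  simpa [dilatedCoeff] using this

lemma exists_of_dilatedCoeff_ne_zero {f : ℝ → ℂ} (hf : Continuous f)
    (hper : Function.Periodic f 1) (hs : Summable (coeff f)) {a k : ℤ} (ha : a ≠ 0)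
    (hne : dilatedCoeff f a k ≠ 0) : ∃ m : ℤ, m * a + k = 0 ∧ dilatedCoeff f a k = coeff f m := by
  have key : HasSum (fun m : ℤ => ∫ x in (0:ℝ)..1, coeff f m * e ((m * a + k : ℤ) * x))
      (dilatedCoeff f a k) := by
    refine hasSum_integral_of_norm_le (b := fun m => ‖coeff f m‖) (fun n => by fun_prop)
      (fun n x => by rw [norm_mul, norm_e, mul_one]) hs.norm fun x => ?_
    refine hasSum_of_eq (fun m => ?_)
      ((hasSum_coeff hf hper hs (a * x)).mul_right (e (k * x)))
    rw [mul_assoc, ← e_add]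
    congr 2
    push_cast
    ring
  simp only [intervalIntegral.integral_const_mul, integral_e_int] at key
  by_cases hm : ∃ m : ℤ, m * a + k = 0
  · obtain ⟨m, hm⟩ := hm
    refine ⟨m, hm, key.unique ?_⟩
    convert hasSum_single m ?_ using 1
    · simp [hm]
    · intro m' hm'
      have : m' * a + k ≠ 0 := fun h0 => hm' (mul_right_cancel₀ ha (by linarith))
      simp [this]
  · push Not at hm
    simp only [hm, if_false, mul_zero] at key
    exact absurd (key.unique hasSum_zero) hne

lemma sum_norm_dilatedCoeff_le {f : ℝ → ℂ} (hf : Continuous f)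
    (hper : Function.Periodic f 1) (hs : Summable (coeff f))
    (hs3 : Summable fun n => ‖coeff f n‖ ^ 3) {a c : ℤ} (ha : a ≠ 0) (hc : c ≠ 0)
    (s : Finset ℤ) :
    ∑ n ∈ s, ‖dilatedCoeff f a (n * c)‖ ^ 3 ≤ ∑' n, ‖coeff f n‖ ^ 3 := by
  classical
  have hex : ∀ n : ℤ, ∃ m : ℤ, dilatedCoeff f a (n * c) ≠ 0 →
      m * a + n * c = 0 ∧ dilatedCoeff f a (n * c) = coeff f m := fun n => by
    by_cases hn : dilatedCoeff f a (n * c) = 0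
    · exact ⟨0, fun h0 => absurd hn h0⟩
    · obtain ⟨m, hm⟩ := exists_of_dilatedCoeff_ne_zero hf hper hs ha hn
      exact ⟨m, fun _ => hm⟩
  choose g hg using hex
  set t := s.filter fun n => dilatedCoeff f a (n * c) ≠ 0 with ht
  have h1 : ∑ n ∈ s, ‖dilatedCoeff f a (n * c)‖ ^ 3 = ∑ n ∈ t, ‖coeff f (g n)‖ ^ 3 := by
    rw [ht, Finset.sum_filter]
    refine Finset.sum_congr rfl fun n _ => ?_
    split_ifs with hn
    · rw [(hg n hn).2]
    · simp [not_not.1 hn]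
  have hinj : Set.InjOn g t := fun x hx y hy hxy => by
    have hx' := (hg x (Finset.mem_filter.1 hx).2).1
    have hy' := (hg y (Finset.mem_filter.1 hy).2).1
    rw [hxy] at hx'
    exact mul_right_cancel₀ hc (by linarith)
  rw [h1, ← Finset.sum_image (f := fun m => ‖coeff f m‖ ^ 3) hinj]
  exact hs3.sum_le_tsum _ fun n _ => by positivity

lemma mul_mul_le_add_cubes {x y z : ℝ} (hx : 0 ≤ x) (hy : 0 ≤ y) (hz : 0 ≤ z) :
    x * y * z ≤ (x ^ 3 + y ^ 3 + z ^ 3) / 3 := by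
  nlinarith [mul_nonneg (add_nonneg (add_nonneg hx hy) hz)
    (add_nonneg (add_nonneg (sq_nonneg (x - y)) (sq_nonneg (y - z))) (sq_nonneg (z - x)))]

theorem norm_integral_correlation_le {f : ℝ → ℂ} (hf : Continuous f)
    (hper : Function.Periodic f 1) (hs : Summable (coeff f))
    (hs3 : Summable fun n => ‖coeff f n‖ ^ 3) {B : ℝ} (hB : ∀ x, ‖f x‖ ≤ B) {a b c d : ℤ}
    (ha : a ≠ 0) (hb : b ≠ 0) (hc : c ≠ 0) (hd : d ≠ 0) :
    ‖∫ α in (0:ℝ)..1, ∫ β in (0:ℝ)..1, f (a * α) * f (b * β) * f (c * α + d * β)‖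
      ≤ ∑' n, ‖coeff f n‖ ^ 3 := by
  have hB0 : 0 ≤ B := (norm_nonneg _).trans (hB 0)
  have inner (α : ℝ) : HasSum
      (fun n : ℤ => coeff f n * f (a * α) * e ((n * c : ℤ) * α) * dilatedCoeff f b (n * d))
      (∫ β in (0:ℝ)..1, f (a * α) * f (b * β) * f (c * α + d * β)) := by
    simp only [dilatedCoeff, ← intervalIntegral.integral_const_mul]
    refine hasSum_integral_of_norm_le (b := fun n => ‖coeff f n‖ * B * B) (fun n => by fun_prop)
      (fun n x => ?_) ((hs.norm.mul_right B).mul_right B) fun β => ?_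
    · simp only [norm_mul, norm_e, mul_one]
      gcongr
      exacts [hB _, hB _]
    · refine hasSum_of_eq (fun n => ?_)
        ((hasSum_coeff hf hper hs (c * α + d * β)).mul_left (f (a * α) * f (b * β)))
      have : e (n * (c * α + d * β)) = e ((n * c : ℤ) * α) * e ((n * d : ℤ) * β) := by
        rw [← e_add]
        congr 1
        push_cast
        ring
      rw [this]
      ring
  have outer : HasSum
      (fun n : ℤ => coeff f n * dilatedCoeff f b (n * d) * dilatedCoeff f a (n * c))
      (∫ α in (0:ℝ)..1, ∫ β in (0:ℝ)..1, f (a * α) * f (b * β) * f (c * α + d * β)) := by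
    have hunfold (n : ℤ) : coeff f n * dilatedCoeff f b (n * d) * dilatedCoeff f a (n * c) =
        ∫ α in (0:ℝ)..1, coeff f n * dilatedCoeff f b (n * d) *
          (f (a * α) * e ((n * c : ℤ) * α)) := by
      rw [intervalIntegral.integral_const_mul, dilatedCoeff.eq_1 f a]
    simp only [hunfold]
    refine hasSum_integral_of_norm_le (b := fun n => ‖coeff f n‖ * B * B) (fun n => by fun_prop)
      (fun n x => ?_) ((hs.norm.mul_right B).mul_right B) fun α => ?_
    · simp only [norm_mul, norm_e, mul_one]
      gcongr
      exacts [norm_dilatedCoeff_le hB b (n * d), hB _]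
    · refine hasSum_of_eq (fun n => ?_) (inner α)
      ring
  have hfin (s : Finset ℤ) :
      ∑ n ∈ s, ‖coeff f n * dilatedCoeff f b (n * d) * dilatedCoeff f a (n * c)‖
        ≤ ∑' n, ‖coeff f n‖ ^ 3 := by
    have h1 := sum_norm_dilatedCoeff_le hf hper hs hs3 ha hc s
    have h2 := sum_norm_dilatedCoeff_le hf hper hs hs3 hb hd s
    have h3 : ∑ n ∈ s, ‖coeff f n‖ ^ 3 ≤ ∑' n, ‖coeff f n‖ ^ 3 :=
      hs3.sum_le_tsum _ fun n _ => by positivity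
    calc _ ≤ ∑ n ∈ s, (‖coeff f n‖ ^ 3 + ‖dilatedCoeff f b (n * d)‖ ^ 3
          + ‖dilatedCoeff f a (n * c)‖ ^ 3) / 3 := by
          gcongr with n
          rw [norm_mul, norm_mul]
          exact mul_mul_le_add_cubes (norm_nonneg _) (norm_nonneg _) (norm_nonneg _)
      _ ≤ _ := by
          rw [← Finset.sum_div, Finset.sum_add_distrib, Finset.sum_add_distrib]
          linarith
  refine le_of_tendsto outer.norm (.of_forall fun s => ?_)
  exact (norm_sum_le _ _).trans (hfin s)

section smoothWeylSum

variable (P R : ℝ)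

/-- The square `|h(α)|²`, expanded as a trigonometric polynomial. -/
def normSqSum (α : ℝ) : ℝ :=
  ∑ p ∈ smoothA P R ×ˢ smoothA P R, Real.cos (2 * π * ((p.1 : ℝ) ^ 4 - (p.2 : ℝ) ^ 4) * α)

/-- The derivative of `normSqSum`. -/
def normSqSum' (α : ℝ) : ℝ :=
  ∑ p ∈ smoothA P R ×ˢ smoothA P R, -Real.sin (2 * π * ((p.1 : ℝ) ^ 4 - (p.2 : ℝ) ^ 4) * α) *
    (2 * π * ((p.1 : ℝ) ^ 4 - (p.2 : ℝ) ^ 4))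

/-- The second derivative of `normSqSum`. -/
def normSqSum'' (α : ℝ) : ℝ :=
  ∑ p ∈ smoothA P R ×ˢ smoothA P R, -Real.cos (2 * π * ((p.1 : ℝ) ^ 4 - (p.2 : ℝ) ^ 4) * α) *
    (2 * π * ((p.1 : ℝ) ^ 4 - (p.2 : ℝ) ^ 4)) ^ 2

lemma norm_h_sq (α : ℝ) : ‖h P R α‖ ^ 2 = normSqSum P R α := by
  have hre (t : ℝ) : (e t).re = Real.cos (2 * π * t) := by
    have : 2 * (π : ℂ) * Complex.I * t = ((2 * π * t : ℝ) : ℂ) * Complex.I := by push_cast; ring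
    rw [e, this, Complex.exp_ofReal_mul_I_re]
  have him (t : ℝ) : (e t).im = Real.sin (2 * π * t) := by
    have : 2 * (π : ℂ) * Complex.I * t = ((2 * π * t : ℝ) : ℂ) * Complex.I := by push_cast; ring
    rw [e, this, Complex.exp_ofReal_mul_I_im]
  rw [← Complex.normSq_eq_norm_sq, Complex.normSq_apply, h, Complex.re_sum, Complex.im_sum,
    Finset.sum_mul_sum, Finset.sum_mul_sum, ← Finset.sum_product', ← Finset.sum_product',
    ← Finset.sum_add_distrib, normSqSum]
  refine Finset.sum_congr rfl fun p _ => ?_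
  rw [hre, hre, him, him, ← Real.cos_sub]
  ring_nf

lemma hasDerivAt_normSqSum (α : ℝ) : HasDerivAt (normSqSum P R) (normSqSum' P R α) α := by
  unfold normSqSum normSqSum'
  refine HasDerivAt.fun_sum fun p _ => ?_
  have := ((hasDerivAt_id α).const_mul (2 * π * ((p.1 : ℝ) ^ 4 - (p.2 : ℝ) ^ 4))).cos
  simpa using this

lemma hasDerivAt_normSqSum' (α : ℝ) : HasDerivAt (normSqSum' P R) (normSqSum'' P R α) α := by
  unfold normSqSum' normSqSum''
  refine HasDerivAt.fun_sum fun p _ => ?_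
  have := ((hasDerivAt_id α).const_mul
    (2 * π * ((p.1 : ℝ) ^ 4 - (p.2 : ℝ) ^ 4))).sin.neg.mul_const
    (2 * π * ((p.1 : ℝ) ^ 4 - (p.2 : ℝ) ^ 4))
  refine this.congr_deriv ?_
  simp only [id, mul_one]
  ring

@[fun_prop]
lemma continuous_normSqSum'' : Continuous (normSqSum'' P R) := by
  unfold normSqSum''
  fun_prop

@[fun_prop]
lemma continuous_normSqSum' : Continuous (normSqSum' P R) := by
  unfold normSqSum'
  fun_prop

lemma h_periodic : Function.Periodic (h P R) 1 := fun α => by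
  unfold h
  refine Finset.sum_congr rfl fun x _ => ?_
  rw [add_mul, e_add]
  have := e_int ((x : ℤ) ^ 4)
  push_cast at this
  rw [one_mul, this, mul_one]

lemma normSqSum'_one : normSqSum' P R 1 = normSqSum' P R 0 := by
  unfold normSqSum'
  refine Finset.sum_congr rfl fun p _ => ?_
  have := Real.sin_add_int_mul_two_pi 0 ((p.1 : ℤ) ^ 4 - (p.2 : ℤ) ^ 4)
  push_cast at this
  rw [show 2 * π * ((p.1 : ℝ) ^ 4 - (p.2 : ℝ) ^ 4) * 1 =
    0 + ((p.1 : ℝ) ^ 4 - (p.2 : ℝ) ^ 4) * (2 * π) by ring, this, mul_zero]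

variable {P}

lemma card_smoothA_le (hP : 0 ≤ P) : ((smoothA P R).card : ℝ) ≤ P := by
  have h1 : (smoothA P R).card ≤ ⌊P⌋₊ := (Finset.card_filter_le _ _).trans (by simp)
  exact (Nat.cast_le.2 h1).trans (Nat.floor_le hP)

lemma le_of_mem_smoothA (hP : 0 ≤ P) {x : ℕ} (hx : x ∈ smoothA P R) : (x : ℝ) ≤ P :=
  (Nat.cast_le.2 (Finset.mem_Icc.1 (Finset.mem_filter.1 hx).1).2).trans (Nat.floor_le hP)

lemma norm_h_le (hP : 0 ≤ P) (α : ℝ) : ‖h P R α‖ ≤ P := by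
  refine le_trans ?_ (card_smoothA_le R hP)
  refine (norm_sum_le _ _).trans ?_
  simp [norm_e]

lemma abs_sum_smoothA_prod_le (hP : 0 ≤ P) {g : ℕ × ℕ → ℝ} {B : ℝ} (hB0 : 0 ≤ B)
    (hB : ∀ p ∈ smoothA P R ×ˢ smoothA P R, |g p| ≤ B) :
    |∑ p ∈ smoothA P R ×ˢ smoothA P R, g p| ≤ P ^ 2 * B := by
  refine (Finset.abs_sum_le_sum_abs _ _).trans ((Finset.sum_le_card_nsmul _ _ _ hB).trans ?_)
  rw [Finset.card_product, nsmul_eq_mul, Nat.cast_mul, ← sq]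
  have := card_smoothA_le R hP
  gcongr

lemma abs_frequency_le (hP : 0 ≤ P) {p : ℕ × ℕ} (hp : p ∈ smoothA P R ×ˢ smoothA P R) :
    |2 * π * ((p.1 : ℝ) ^ 4 - (p.2 : ℝ) ^ 4)| ≤ 2 * π * P ^ 4 := by
  obtain ⟨h1, h2⟩ := Finset.mem_product.1 hp
  have h3 := pow_le_pow_left₀ (Nat.cast_nonneg _) (le_of_mem_smoothA R hP h1) 4
  have h4 := pow_le_pow_left₀ (Nat.cast_nonneg _) (le_of_mem_smoothA R hP h2) 4
  have h5 : (0 : ℝ) ≤ (p.1 : ℝ) ^ 4 := by positivity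
  have h6 : (0 : ℝ) ≤ (p.2 : ℝ) ^ 4 := by positivity
  rw [abs_mul, abs_of_pos Real.two_pi_pos]
  gcongr
  rw [abs_le]
  constructor <;> linarith

lemma abs_normSqSum'_le (hP : 0 ≤ P) (α : ℝ) : |normSqSum' P R α| ≤ P ^ 2 * (2 * π * P ^ 4) := by
  refine abs_sum_smoothA_prod_le R hP (by positivity) fun p hp => ?_
  rw [abs_mul, abs_neg, ← one_mul (2 * π * P ^ 4)]
  exact mul_le_mul (Real.abs_sin_le_one _) (abs_frequency_le R hP hp) (abs_nonneg _) zero_le_one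

lemma abs_normSqSum''_le (hP : 0 ≤ P) (α : ℝ) :
    |normSqSum'' P R α| ≤ P ^ 2 * (2 * π * P ^ 4) ^ 2 := by
  refine abs_sum_smoothA_prod_le R hP (by positivity) fun p hp => ?_
  rw [abs_mul, abs_neg, abs_pow, ← one_mul ((2 * π * P ^ 4) ^ 2)]
  exact mul_le_mul (Real.abs_cos_le_one _)
    (pow_le_pow_left₀ (abs_nonneg _) (abs_frequency_le R hP hp) 2) (by positivity) zero_le_one

lemma normSqSum_rpow (α : ℝ) (k : ℕ) : normSqSum P R α ^ ((k : ℝ) / 2) = ‖h P R α‖ ^ k := by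
  rw [← norm_h_sq, ← Real.rpow_natCast, ← Real.rpow_natCast, ← Real.rpow_mul (norm_nonneg _)]
  congr 1
  push_cast
  ring

lemma hasDerivAt_norm_h_pow {k : ℕ} (hk : 2 ≤ k) (α : ℝ) :
    HasDerivAt (fun x => ‖h P R x‖ ^ k)
      (normSqSum' P R α * (k / 2) * ‖h P R α‖ ^ (k - 2)) α := by
  have hk' : (1 : ℝ) ≤ (k : ℝ) / 2 := by
    have : (2 : ℝ) ≤ k := by exact_mod_cast hk
    linarith
  have := (hasDerivAt_normSqSum P R α).rpow_const (p := (k : ℝ) / 2) (Or.inr hk')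
  have h2 : (k : ℝ) / 2 - 1 = ((k - 2 : ℕ) : ℝ) / 2 := by
    rw [Nat.cast_sub hk]
    push_cast
    ring
  rw [h2, normSqSum_rpow] at this
  simpa only [normSqSum_rpow] using this

/-- The function `|h|⁷`, as a complex-valued function. -/
def hSeven (P R α : ℝ) : ℂ := (‖h P R α‖ : ℂ) ^ 7

lemma norm_hSeven (α : ℝ) : ‖hSeven P R α‖ = ‖h P R α‖ ^ 7 := by
  simp [hSeven]

lemma coeff_hSeven : coeff (hSeven P R) = ψ P R := rfl

@[fun_prop]
lemma continuous_h : Continuous (h P R) := by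
  unfold h
  fun_prop

@[fun_prop]
lemma continuous_hSeven : Continuous (hSeven P R) := by
  unfold hSeven
  fun_prop

lemma hSeven_periodic : Function.Periodic (hSeven P R) 1 := fun α => by
  rw [hSeven, h_periodic, hSeven]

lemma sq_mul_norm_ψ_le (hP : 0 ≤ P) (n : ℤ) : (n : ℝ) ^ 2 * ‖ψ P R n‖ ≤ 49 / 4 * P ^ 15 := by
  set F' : ℝ → ℝ := fun α => normSqSum' P R α * ((7 : ℕ) / 2) * ‖h P R α‖ ^ 5 with hF'
  set F'' : ℝ → ℝ := fun α => normSqSum'' P R α * ((7 : ℕ) / 2) * ‖h P R α‖ ^ 5 +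
    normSqSum' P R α * ((7 : ℕ) / 2) * (normSqSum' P R α * ((5 : ℕ) / 2) * ‖h P R α‖ ^ 3) with hF''
  have d1 (x : ℝ) : HasDerivAt (hSeven P R) ((F' x : ℝ) : ℂ) x := by
    have := (hasDerivAt_norm_h_pow (P := P) R (k := 7) (by norm_num) x).ofReal_comp
    have hfun : hSeven P R = fun y => ((‖h P R y‖ ^ 7 : ℝ) : ℂ) := by
      funext y
      rw [hSeven, Complex.ofReal_pow]
    rw [hfun]
    exact this
  have d2 (x : ℝ) : HasDerivAt (fun y => ((F' y : ℝ) : ℂ)) ((F'' x : ℝ) : ℂ) x :=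
    (((hasDerivAt_normSqSum' P R x).mul_const _).mul
      (hasDerivAt_norm_h_pow (P := P) R (k := 5) (by norm_num) x)).ofReal_comp
  have hbound (x : ℝ) : ‖((F'' x : ℝ) : ℂ)‖ ≤ 49 * π ^ 2 * P ^ 15 := by
    have b1 := abs_normSqSum'_le R hP x
    have b2 := abs_normSqSum''_le R hP x
    have b3 := norm_h_le R hP x
    rw [Complex.norm_real, Real.norm_eq_abs]
    calc |F'' x| ≤ |normSqSum'' P R x| * (7 / 2) * ‖h P R x‖ ^ 5 +
        |normSqSum' P R x| * (7 / 2) * (|normSqSum' P R x| * (5 / 2) * ‖h P R x‖ ^ 3) := by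
          refine (abs_add_le _ _).trans (le_of_eq ?_)
          simp only [abs_mul, abs_pow, abs_norm, Nat.cast_ofNat]
          norm_num [abs_of_pos]
      _ ≤ (P ^ 2 * (2 * π * P ^ 4) ^ 2) * (7 / 2) * P ^ 5 +
        (P ^ 2 * (2 * π * P ^ 4)) * (7 / 2) * ((P ^ 2 * (2 * π * P ^ 4)) * (5 / 2) * P ^ 3) := by
          gcongr
      _ = 49 * π ^ 2 * P ^ 15 := by ring
  have hper : hSeven P R 1 = hSeven P R 0 := by simpa using hSeven_periodic (P := P) R 0
  have hper' : ((F' 1 : ℝ) : ℂ) = ((F' 0 : ℝ) : ℂ) := by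
    have h0 : h P R 1 = h P R 0 := by simpa using h_periodic P R 0
    simp only [hF', h0, normSqSum'_one]
  have key := norm_coeff_le_of_deriv_two (n := n) d1 d2
    (Complex.continuous_ofReal.comp (by fun_prop)) hper hper' hbound
  rw [coeff_hSeven] at key
  have hpi : 0 < 4 * π ^ 2 := by positivity
  refine le_of_mul_le_mul_left ?_ hpi
  linarith

lemma norm_ψ_le (hP : 0 ≤ P) (n : ℤ) : ‖ψ P R n‖ ≤ P ^ 7 := by
  rw [← coeff_hSeven]
  refine norm_coeff_le (fun x => ?_) n
  rw [norm_hSeven]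
  gcongr
  exact norm_h_le R hP x

lemma summable_ψ (hP : 0 ≤ P) : Summable (ψ P R) := by
  have hs : Summable fun n : ℤ => 49 / 4 * P ^ 15 * (1 / (n : ℝ) ^ 2) :=
    (Real.summable_one_div_int_pow.2 one_lt_two).mul_left _
  refine hs.of_norm_bounded_eventually ?_
  rw [Filter.eventually_cofinite]
  refine (Set.finite_singleton (0 : ℤ)).subset fun n hn => ?_
  by_contra hn0
  refine hn ?_
  have : (0 : ℝ) < (n : ℝ) ^ 2 := by
    have : (n : ℝ) ≠ 0 := by exact_mod_cast hn0
    positivity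
  rw [mul_one_div, le_div_iff₀ this, mul_comm]
  exact sq_mul_norm_ψ_le R hP n

lemma summable_norm_ψ_pow_three (hP : 0 ≤ P) : Summable fun n => ‖ψ P R n‖ ^ 3 := by
  refine .of_nonneg_of_le (fun n => by positivity) (fun n => ?_)
    ((summable_ψ R hP).norm.mul_left ((P ^ 7) ^ 2))
  rw [pow_succ]
  gcongr
  exact norm_ψ_le R hP n

lemma norm_ψ_pow_three_le_of_large (hP : 0 < P) {n : ℤ} (hn : P ^ 9 ≤ |(n : ℝ)|) :
    ‖ψ P R n‖ ^ 3 ≤ (49 / 4) ^ 3 * P ^ 9 * (1 / (n : ℝ) ^ 2) := by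
  have hn0 : 0 < |(n : ℝ)| := lt_of_lt_of_le (by positivity) hn
  have h1 := sq_mul_norm_ψ_le R hP.le n
  rw [← sq_abs (n : ℝ)] at h1 ⊢
  set m := |(n : ℝ)|
  rw [mul_one_div, le_div_iff₀ (by positivity)]
  have h2 : (m ^ 2 * ‖ψ P R n‖) ^ 3 ≤ (49 / 4 * P ^ 15) ^ 3 := by gcongr
  have h3 : (P ^ 9) ^ 4 ≤ m ^ 4 := by gcongr
  refine le_of_mul_le_mul_left ?_ (by positivity : 0 < m ^ 4)
  calc m ^ 4 * (‖ψ P R n‖ ^ 3 * m ^ 2) = (m ^ 2 * ‖ψ P R n‖) ^ 3 := by ring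
    _ ≤ (49 / 4 * P ^ 15) ^ 3 := h2
    _ = (P ^ 9) ^ 4 * ((49 / 4) ^ 3 * P ^ 9) := by ring
    _ ≤ m ^ 4 * ((49 / 4) ^ 3 * P ^ 9) := by gcongr

lemma tsum_norm_ψ_pow_three_le (hP : 2 ≤ P) :
    ∑' n, ‖ψ P R n‖ ^ 3 ≤ (3 + (49 / 4) ^ 3 * ∑' n : ℤ, 1 / (n : ℝ) ^ 2) * (P ^ 9 +
      ∑ n ∈ (Finset.Icc (-⌊P ^ 9⌋) ⌊P ^ 9⌋).filter (fun n => 1 < ‖ψ P R n‖), ‖ψ P R n‖ ^ 3) := by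
  have hP0 : 0 < P := by linarith
  set N := ⌊P ^ 9⌋ with hN
  have hNP : (N : ℝ) ≤ P ^ 9 := Int.floor_le _
  have hN0 : 0 ≤ N := Int.floor_nonneg.2 (by positivity)
  have hP9 : 1 ≤ P ^ 9 := one_le_pow₀ (by linarith)
  set Z := ∑' n : ℤ, 1 / (n : ℝ) ^ 2 with hZ
  have hZ0 : 0 ≤ Z := tsum_nonneg fun n => by positivity
  set S := ∑ n ∈ (Finset.Icc (-N) N).filter (fun n => 1 < ‖ψ P R n‖), ‖ψ P R n‖ ^ 3 with hS
  have hS0 : 0 ≤ S := Finset.sum_nonneg fun n _ => by positivity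
  have hsZ : Summable fun n : ℤ => (49 / 4) ^ 3 * P ^ 9 * (1 / (n : ℝ) ^ 2) :=
    (Real.summable_one_div_int_pow.2 one_lt_two).mul_left _
  have hsmall : ∑ n ∈ Finset.Icc (-N) N, ‖ψ P R n‖ ^ 3 ≤ S + 3 * P ^ 9 := by
    rw [← Finset.sum_filter_add_sum_filter_not _ (fun n => 1 < ‖ψ P R n‖)]
    gcongr
    have hle : ∀ n ∈ (Finset.Icc (-N) N).filter (fun n => ¬1 < ‖ψ P R n‖), ‖ψ P R n‖ ^ 3 ≤ 1 :=
      fun n hn => pow_le_one₀ (norm_nonneg _) (not_lt.1 (Finset.mem_filter.1 hn).2)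
    refine (Finset.sum_le_card_nsmul _ _ _ hle).trans ?_
    rw [nsmul_eq_mul, mul_one]
    have hcard : (((Finset.Icc (-N) N).card : ℤ) : ℝ) = 2 * N + 1 := by
      rw [Int.card_Icc, Int.toNat_of_nonneg (by linarith)]
      push_cast
      ring
    have hcard' : (((Finset.Icc (-N) N).filter (fun n => ¬1 < ‖ψ P R n‖)).card : ℝ) ≤
        (Finset.Icc (-N) N).card := by exact_mod_cast Finset.card_filter_le _ _
    push_cast at hcard
    linarith
  have hfin (s : Finset ℤ) : ∑ n ∈ s, ‖ψ P R n‖ ^ 3 ≤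
      (S + 3 * P ^ 9) + (49 / 4) ^ 3 * P ^ 9 * Z := by
    rw [← Finset.sum_filter_add_sum_filter_not s (fun n => n ∈ Finset.Icc (-N) N)]
    refine add_le_add (le_trans ?_ hsmall) ?_
    · exact Finset.sum_le_sum_of_subset_of_nonneg (fun n hn => (Finset.mem_filter.1 hn).2)
        fun n _ _ => by positivity
    · rw [hZ, ← tsum_mul_left]
      refine le_trans (Finset.sum_le_sum fun n hn => ?_)
        (hsZ.sum_le_tsum (s.filter fun n => n ∉ Finset.Icc (-N) N) fun n _ => by positivity)
      refine norm_ψ_pow_three_le_of_large R hP0 ?_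
      have hn2 := (Finset.mem_filter.1 hn).2
      rw [Finset.mem_Icc, ← abs_le, not_le, hN, Int.floor_lt] at hn2
      exact_mod_cast hn2.le
  refine ((summable_norm_ψ_pow_three R hP0.le).tsum_le_of_sum_le hfin).trans ?_
  have : 0 ≤ (49 / 4) ^ 3 * Z * S := by positivity
  linarith

end smoothWeylSum

/-- there is an absolute constant `C` such that for all `P ≥ 2`, `2 ≤ R ≤ P`
and nonzero integers `a, b, c, d`, one has
`I(a,b,c,d) ≤ C·(P⁹ + Σ_{|n|≤P⁹, |ψ(n)|>1} |ψ(n)|³)`. -/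
theorem correlation_truncated_bound :
    ∃ C : ℝ, ∀ P R : ℝ, 2 ≤ P → 2 ≤ R → R ≤ P →
      ∀ a b c d : ℤ, a ≠ 0 → b ≠ 0 → c ≠ 0 → d ≠ 0 →
        Icorr P R a b c d ≤
          C * (P ^ 9 +
            ∑ n ∈ (Finset.Icc (-⌊P ^ 9⌋) ⌊P ^ 9⌋).filter (fun n => 1 < ‖ψ P R n‖),
              ‖ψ P R n‖ ^ 3) := by
  refine ⟨3 + (49 / 4) ^ 3 * ∑' n : ℤ, 1 / (n : ℝ) ^ 2, fun P R hP _ _ a b c d ha hb hc hd => ?_⟩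
  refine le_trans ?_ (tsum_norm_ψ_pow_three_le R hP)
  have hP0 : 0 ≤ P := by linarith
  have key := norm_integral_correlation_le (continuous_hSeven (P := P) R) (hSeven_periodic R)
    (summable_ψ R hP0) (summable_norm_ψ_pow_three R hP0) (B := P ^ 7)
    (fun x => by rw [norm_hSeven]; gcongr; exact norm_h_le R hP0 x) ha hb hc hd
  rw [coeff_hSeven] at key
  refine le_trans (le_of_eq_of_le ?_ (Complex.re_le_norm _)) key
  rw [Icorr, ← Complex.ofReal_re (∫ α in (0:ℝ)..1, _), ← intervalIntegral.integral_ofReal]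
  simp only [← intervalIntegral.integral_ofReal, hSeven, norm_mul, mul_pow, Complex.ofReal_mul,
    Complex.ofReal_pow]
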